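/- arXiv:2508.05965 — 2 statements merged into one kernel-verified Lean document; each statement's English description precedes it below -/
import Mathlib

section
/- (q-Gauss summation) For |q| < 1 and |c/(ab)| < 1, with c not of the form q^{-j} for nonnegative integers j, one has ${}_2\phi_1(a, b; c; q, c/(ab)) = \frac{(c/a; q)_\infty (c/b; q)_\infty}{(c; q)_\infty (c/(ab); q)_\infty}$. -/
open Finset

noncomputable def qPoch (a q : ℂ) (n : ℕ) : ℂ := ∏ j ∈ Finset.range n, (1 - a * q ^ j)

noncomputable def qPochInf (a q : ℂ) : ℂ := ∏' j : ℕ, (1 - a * q ^ j)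

noncomputable def phi (a b c q x : ℂ) : ℂ :=
  ∑' i : ℕ, qPoch a q i * qPoch b q i / (qPoch q q i * qPoch c q i) * x ^ i

lemma qP_mult (a q : ℂ) (hq : ‖q‖ < 1) : Summable (fun j : ℕ => ‖-(a * q ^ j)‖) := by
  simp only [norm_neg, norm_mul, norm_pow]
  exact (summable_geometric_of_lt_one (norm_nonneg _) hq).mul_left _

lemma qP_tendsto (a q : ℂ) (hq : ‖q‖ < 1) :
    Filter.Tendsto (fun n => qPoch a q n) Filter.atTop (nhds (qPochInf a q)) := by
  have h := (multipliable_one_add_of_summable (qP_mult a q hq)).hasProd.tendsto_prod_nat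
  simpa [qPoch, qPochInf, sub_eq_add_neg] using h

lemma qP_inf_ne (a q : ℂ) (hq : ‖q‖ < 1) (h : ∀ j : ℕ, a * q ^ j ≠ 1) : qPochInf a q ≠ 0 := by
  have h := tprod_one_add_ne_zero_of_summable (f := fun j : ℕ => -(a * q ^ j))
    (fun j => by rw [← sub_eq_add_neg]; exact sub_ne_zero.2 (h j).symm) (qP_mult a q hq)
  simpa [qPochInf, sub_eq_add_neg] using h

lemma qP_ne (a q : ℂ) (h : ∀ j : ℕ, a * q ^ j ≠ 1) (n : ℕ) : qPoch a q n ≠ 0 :=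
  Finset.prod_ne_zero_iff.2 fun j _ => sub_ne_zero.2 (h j).symm

lemma qP_add (a q : ℂ) (m n : ℕ) : qPoch a q (m + n) = qPoch a q m * qPoch (a * q ^ m) q n := by
  simp only [qPoch, Finset.prod_range_add, pow_add, mul_assoc]

lemma qP_succ (a q : ℂ) (n : ℕ) : qPoch a q (n + 1) = qPoch a q n * (1 - a * q ^ n) :=
  Finset.prod_range_succ _ _

lemma tends_bdd {f : ℕ → ℂ} {l : ℂ} (h : Filter.Tendsto f Filter.atTop (nhds l)) :
    ∃ C : ℝ, 0 ≤ C ∧ ∀ n, ‖f n‖ ≤ C := by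
  obtain ⟨C, hC⟩ := (Metric.isBounded_range_of_tendsto f h).exists_norm_le
  exact ⟨C, (norm_nonneg _).trans (hC (f 0) ⟨0, rfl⟩), fun n => hC _ ⟨n, rfl⟩⟩

lemma qP_bdd (a q : ℂ) (hq : ‖q‖ < 1) : ∃ C : ℝ, 0 ≤ C ∧ ∀ n, ‖qPoch a q n‖ ≤ C :=
  tends_bdd (qP_tendsto a q hq)

lemma qP_inv_bdd (a q : ℂ) (hq : ‖q‖ < 1) (h : ∀ j : ℕ, a * q ^ j ≠ 1) :
    ∃ C : ℝ, 0 ≤ C ∧ ∀ n, ‖(qPoch a q n)⁻¹‖ ≤ C :=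
  tends_bdd ((qP_tendsto a q hq).inv₀ (qP_inf_ne a q hq h))

lemma small_ne (q x : ℂ) (hq : ‖q‖ < 1) (hx : ‖x‖ < 1) (j : ℕ) : x * q ^ j ≠ 1 := by
  intro h
  have h1 : ‖x * q ^ j‖ = 1 := by rw [h]; simp
  rw [norm_mul, norm_pow] at h1
  have : ‖q‖ ^ j ≤ 1 := pow_le_one₀ (norm_nonneg _) hq.le
  nlinarith [norm_nonneg x, norm_nonneg q]

noncomputable def TT (a b q x : ℂ) (i : ℕ) : ℂ :=
  qPoch a q i * qPoch b q i / (qPoch q q i * qPoch (a * b * x) q i) * x ^ i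

lemma TT_bdd (a b q x : ℂ) (hq : ‖q‖ < 1) (hc : ∀ j : ℕ, a * b * x * q ^ j ≠ 1) :
    ∃ C : ℝ, 0 ≤ C ∧ ∀ N i, ‖TT a b q (x * q ^ N) i‖ ≤ C * ‖x * q ^ N‖ ^ i := by
  obtain ⟨A, hA, hA'⟩ := qP_bdd a q hq
  obtain ⟨B, hB, hB'⟩ := qP_bdd b q hq
  obtain ⟨D, hD, hD'⟩ := qP_bdd (a * b * x) q hq
  obtain ⟨Q, hQ, hQ'⟩ := qP_inv_bdd q q hq (small_ne q q hq hq)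
  obtain ⟨E, hE, hE'⟩ := qP_inv_bdd (a * b * x) q hq hc
  refine ⟨A * B * (Q * (D * E)), by positivity, fun N i => ?_⟩
  have e : (qPoch (a * b * (x * q ^ N)) q i)⁻¹
      = qPoch (a * b * x) q N * (qPoch (a * b * x) q (N + i))⁻¹ := by
    have h1 := qP_ne _ q hc N
    rw [qP_add, mul_inv, mul_inv_cancel_left₀ h1, mul_assoc (a * b)]
  rw [TT, div_eq_mul_inv, mul_inv, e]
  simp only [norm_mul, norm_pow]
  have k1 := hA' i
  have k2 := hB' i
  have k3 := hQ' i
  have k4 := hD' N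
  have k5 := hE' (N + i)
  clear hA' hB' hQ' hD' hE' e
  have p1 := norm_nonneg (qPoch a q i)
  have p2 := norm_nonneg (qPoch b q i)
  have p3 := norm_nonneg (qPoch q q i)⁻¹
  have p4 := norm_nonneg (qPoch (a * b * x) q N)
  have p5 := norm_nonneg (qPoch (a * b * x) q (N + i))⁻¹
  have p6 : 0 ≤ (‖x‖ * ‖q‖ ^ N) ^ i := by positivity
  exact mul_le_mul_of_nonneg_right
    (mul_le_mul (mul_le_mul k1 k2 p2 hA)
      (mul_le_mul k3 (mul_le_mul k4 k5 p5 hD) (mul_nonneg p4 p5) hQ)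
      (mul_nonneg p3 (mul_nonneg p4 p5)) (mul_nonneg hA hB)) p6

lemma TT_rec (a b q x : ℂ) (hq : ‖q‖ < 1) (hc : ∀ j : ℕ, a * b * x * q ^ j ≠ 1) (i : ℕ) :
    (1 - a * b * x) * (1 - x) * TT a b q x i - (1 - a * x) * (1 - b * x) * TT a b q (x * q) i
      = -(1 - a * b * x) * (1 - q ^ (i + 1)) * TT a b q x (i + 1)
        - (-(1 - a * b * x) * (1 - q ^ i) * TT a b q x i) := by
  have hQ := qP_ne q q (small_ne q q hq hq) i
  have hC := qP_ne _ q hc i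
  have h0 : 1 - a * b * x ≠ 0 := sub_ne_zero.2 (by simpa using (hc 0).symm)
  have hi : 1 - a * b * x * q ^ i ≠ 0 := sub_ne_zero.2 (hc i).symm
  have hqi : 1 - q * q ^ i ≠ 0 := sub_ne_zero.2 (small_ne q q hq hq i).symm
  have e : qPoch (a * b * (x * q)) q i
      = qPoch (a * b * x) q i * (1 - a * b * x * q ^ i) / (1 - a * b * x) := by
    rw [eq_div_iff h0, ← qP_succ, add_comm i 1, qP_add, pow_one, mul_assoc (a * b)]
    simp only [qPoch, Finset.prod_range_one, pow_zero, mul_one]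
    rw [mul_comm]
  simp only [TT, e, qP_succ, mul_pow, pow_succ']
  generalize qPoch (a * b * x) q i = C at *
  generalize qPoch q q i = Q at *
  generalize qPoch a q i = A at *
  generalize qPoch b q i = B at *
  generalize q ^ i = z at *
  generalize x ^ i = y at *
  have hqi2 : 1 - z * q ≠ 0 := by rwa [mul_comm]
  field_simp
  ring

lemma TT_summable (a b q x : ℂ) (hq : ‖q‖ < 1) (hx : ‖x‖ < 1)
    (hc : ∀ j : ℕ, a * b * x * q ^ j ≠ 1) : Summable (TT a b q x) := by
  obtain ⟨C, _, h⟩ := TT_bdd a b q x hq hc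
  refine Summable.of_norm_bounded
    ((summable_geometric_of_lt_one (norm_nonneg x) hx).mul_left C) fun i => ?_
  simpa using h 0 i

lemma hc_shift (a b q x : ℂ) (hc : ∀ j : ℕ, a * b * x * q ^ j ≠ 1) (N : ℕ) :
    ∀ j : ℕ, a * b * (x * q ^ N) * q ^ j ≠ 1 := fun j => by
  have := hc (N + j)
  rwa [pow_add, ← mul_assoc, mul_assoc (a * b)] at this

lemma hx_shift (q x : ℂ) (hq : ‖q‖ < 1) (hx : ‖x‖ < 1) (N : ℕ) : ‖x * q ^ N‖ < 1 := by
  rw [norm_mul, norm_pow]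
  have : ‖q‖ ^ N ≤ 1 := pow_le_one₀ (norm_nonneg _) hq.le
  nlinarith [norm_nonneg x]

lemma FF_rec (a b q x : ℂ) (hq : ‖q‖ < 1) (hx : ‖x‖ < 1)
    (hc : ∀ j : ℕ, a * b * x * q ^ j ≠ 1) :
    (1 - a * b * x) * (1 - x) * ∑' i, TT a b q x i
      = (1 - a * x) * (1 - b * x) * ∑' i, TT a b q (x * q) i := by
  have s1 := TT_summable a b q x hq hx hc
  have s2 := TT_summable a b q (x * q) hq (by simpa using hx_shift q x hq hx 1)
    (by simpa using hc_shift a b q x hc 1)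
  have h := ((s1.hasSum.mul_left ((1 - a * b * x) * (1 - x))).sub
    (s2.hasSum.mul_left ((1 - a * x) * (1 - b * x)))).tendsto_sum_nat
  have hG : Filter.Tendsto (fun n : ℕ => -(1 - a * b * x) * (1 - q ^ n) * TT a b q x n)
      Filter.atTop (nhds (-(1 - a * b * x) * (1 - 0) * 0)) :=
    ((tendsto_const_nhds.sub (tendsto_pow_atTop_nhds_zero_of_norm_lt_one hq)).const_mul _).mul
      s1.tendsto_atTop_zero
  simp only [TT_rec a b q x hq hc] at h
  simp only [Finset.sum_range_sub (fun n : ℕ => -(1 - a * b * x) * (1 - q ^ n) * TT a b q x n)] at h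
  simp only [pow_zero, sub_self, mul_zero, zero_mul, sub_zero] at h hG
  exact sub_eq_zero.1 (tendsto_nhds_unique h hG)

lemma FF_iter (a b q x : ℂ) (hq : ‖q‖ < 1) (hx : ‖x‖ < 1)
    (hc : ∀ j : ℕ, a * b * x * q ^ j ≠ 1) (N : ℕ) :
    qPoch (a * b * x) q N * qPoch x q N * ∑' i, TT a b q x i
      = qPoch (a * x) q N * qPoch (b * x) q N * ∑' i, TT a b q (x * q ^ N) i := by
  induction N with
  | zero => simp [qPoch]
  | succ N ih =>
    have h := FF_rec a b q (x * q ^ N) hq (hx_shift q x hq hx N) (hc_shift a b q x hc N)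
    simp only [qP_succ]
    rw [pow_succ, ← mul_assoc x]
    linear_combination (1 - a * b * x * q ^ N) * (1 - x * q ^ N) * ih
      + qPoch (a * x) q N * qPoch (b * x) q N * h

lemma FF_lim (a b q x : ℂ) (hq : ‖q‖ < 1) (hx : ‖x‖ < 1)
    (hc : ∀ j : ℕ, a * b * x * q ^ j ≠ 1) :
    Filter.Tendsto (fun N : ℕ => ∑' i, TT a b q (x * q ^ N) i) Filter.atTop (nhds 1) := by
  obtain ⟨C, hC, h⟩ := TT_bdd a b q x hq hc
  have hz : Filter.Tendsto (fun N : ℕ => ‖x * q ^ N‖) Filter.atTop (nhds 0) := by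
    have := ((tendsto_pow_atTop_nhds_zero_of_norm_lt_one hq).const_mul x).norm
    simpa using this
  have key := tendsto_tsum_of_dominated_convergence (𝓕 := Filter.atTop)
    (f := fun (N : ℕ) i => TT a b q (x * q ^ N) i) (g := fun i : ℕ => if i = 0 then (1 : ℂ) else 0)
    (bound := fun i => C * ‖x‖ ^ i)
    ((summable_geometric_of_lt_one (norm_nonneg x) hx).mul_left C) ?_ ?_
  · simpa using key
  · intro i
    rcases Nat.eq_zero_or_pos i with rfl | hi
    · simp [TT, qPoch]
    · rw [if_neg hi.ne']
      refine squeeze_zero_norm (fun N => h N i) ?_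
      have := (hz.pow i).const_mul C
      simpa [hi.ne'] using this
  · refine Filter.Eventually.of_forall fun N i => (h N i).trans ?_
    have : ‖q‖ ^ N ≤ 1 := pow_le_one₀ (norm_nonneg _) hq.le
    gcongr
    rw [norm_mul, norm_pow]
    nlinarith [norm_nonneg x]

theorem stmt_1 (q a b c : ℂ) (hq : ‖q‖ < 1) (ha : a ≠ 0) (hb : b ≠ 0)
    (hx : ‖c / (a * b)‖ < 1) (hc : ∀ j : ℕ, c * q ^ j ≠ 1) :
    phi a b c q (c / (a * b)) =
      qPochInf (c / a) q * qPochInf (c / b) q /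
        (qPochInf c q * qPochInf (c / (a * b)) q) := by
  obtain ⟨x, hxd⟩ : ∃ x, x = c / (a * b) := ⟨_, rfl⟩
  have hcx : c = a * b * x := by rw [hxd]; field_simp
  have e1 : c / a = b * x := by rw [hcx]; field_simp
  have e2 : c / b = a * x := by rw [hcx]; field_simp
  rw [← hxd] at hx ⊢
  rw [e1, e2]
  subst hcx
  have h1 := qP_inf_ne _ q hq hc
  have h2 := qP_inf_ne x q hq (small_ne q x hq hx)
  rw [eq_div_iff (mul_ne_zero h1 h2)]
  have L := ((qP_tendsto (a * b * x) q hq).mul (qP_tendsto x q hq)).mul_const (∑' i, TT a b q x i)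
  have R := ((qP_tendsto (a * x) q hq).mul (qP_tendsto (b * x) q hq)).mul (FF_lim a b q x hq hx hc)
  simp only [FF_iter a b q x hq hx hc] at L
  have := tendsto_nhds_unique L R
  have hp : phi a b (a * b * x) q x = ∑' i, TT a b q x i := rfl
  rw [hp]
  linear_combination this
end

section
/- For nonnegative integers M and N, with |q| < 1 and q not a root of unity, the terminating sum $\sum_{i=0}^{N} \frac{(q^{-N};q)_i (q^{-M-2N-2};q)_i}{(q;q)_i (q^{-M-N-1};q)_i} (-q^{N+1})^i$ equals $\frac{(-q;q)_N (q^{M+3}; q^2)_N}{q^{N(N+1)/2} (q^{M+2}; q)_N}$. -/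
open Finset

lemma qp_succ (a q : ℂ) (n : ℕ) : qPoch a q (n+1) = qPoch a q n * (1 - a * q ^ n) := by
  simp [qPoch, Finset.prod_range_succ]

lemma qp_zero (a q : ℂ) : qPoch a q 0 = 1 := by simp [qPoch]

lemma qp_succ_left (a q : ℂ) (n : ℕ) : qPoch a q (n+1) = (1 - a) * qPoch (a * q) q n := by
  simp only [qPoch, Finset.prod_range_succ']
  rw [mul_comm]
  congr 1
  · simp
  · apply Finset.prod_congr rfl
    intro j _
    ring

lemma qp_add (a q : ℂ) (k i : ℕ) : qPoch a q (k+i) = qPoch a q k * qPoch (a * q ^ k) q i := by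
  simp only [qPoch, Finset.prod_range_add]
  congr 1
  apply Finset.prod_congr rfl
  intro j _
  ring

def tri (k : ℕ) : ℕ := k * (k + 1) / 2

lemma tri_zero : tri 0 = 0 := rfl

lemma tri_succ (k : ℕ) : tri (k+1) = tri k + k + 1 := by
  unfold tri
  have : (k + 1) * (k + 1 + 1) = k * (k+1) + (k + 1) * 2 := by ring
  rw [this, Nat.add_mul_div_right _ _ (by norm_num)]
  ring

lemma tri_add (k i : ℕ) : tri (k+i) = tri k + tri i + k * i := by
  induction i with
  | zero => simp [tri_zero]
  | succ i ih => rw [← add_assoc, tri_succ, ih, tri_succ]; ring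

lemma qp_ne (q : ℂ) (hroot : ∀ n : ℕ, 0 < n → q ^ n ≠ 1) (m i : ℕ) :
    qPoch (q ^ (m+1)) q i ≠ 0 := by
  unfold qPoch
  rw [Finset.prod_ne_zero_iff]
  intro j _ h
  apply hroot (m+1+j) (by omega)
  rw [pow_add]
  linear_combination -h

lemma qp_ne' (q : ℂ) (hroot : ∀ n : ℕ, 0 < n → q ^ n ≠ 1) (i : ℕ) :
    qPoch q q i ≠ 0 := by
  simpa using qp_ne q hroot 0 i

lemma qp_neg (q : ℂ) (hq0 : q ≠ 0) (m i : ℕ) :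
    qPoch (q ^ (-((m : ℤ) + i))) q i * q ^ (m * i + tri i) = (-1) ^ i * qPoch (q ^ (m+1)) q i := by
  induction i with
  | zero => simp [qp_zero, tri_zero]
  | succ i ih =>
    rw [qp_succ_left, qp_succ]
    have e1 : q ^ (-((m : ℤ) + ((i+1 : ℕ) : ℤ))) * q = q ^ (-((m : ℤ) + i)) := by
      rw [← zpow_add_one₀ hq0]; congr 1; push_cast; ring
    have e2 : q ^ (-((m : ℤ) + ((i+1 : ℕ) : ℤ))) * q ^ (m + i + 1) = 1 := by
      rw [← zpow_natCast, ← zpow_add₀ hq0, ← zpow_zero q]; congr 1; push_cast; ring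
    have e3 : m * (i+1) + tri (i+1) = (m * i + tri i) + (m + i + 1) := by
      rw [tri_succ]; ring
    rw [e1, e3, pow_add q (m * i + tri i)]
    have e4 : q ^ (m+1) * q ^ i = q ^ (m+i+1) := by ring
    rw [e4]
    generalize q ^ (-((m : ℤ) + ((i+1 : ℕ) : ℤ))) = a at *
    rw [pow_succ (-1 : ℂ)]
    linear_combination (1 - a) * q ^ (m+i+1) * ih - (-1) ^ i * qPoch (q ^ (m+1)) q i * e2

noncomputable def ff (q y : ℂ) (k j : ℕ) : ℂ :=
  qPoch q q (k+j) / (qPoch q q k * qPoch q q j) * q ^ tri k * qPoch y q k *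
    qPoch (y * q ^ (2*k+j+1)) q j

noncomputable def hh (q y : ℂ) (k j : ℕ) : ℂ :=
  -(q ^ (j + tri (k+1)) * (qPoch q q (k+j) / (qPoch q q k * qPoch q q j)) * qPoch y q (k+1) *
    qPoch (y * q ^ (2*k+j+2)) q j)

lemma one_sub_ne (q : ℂ) (hroot : ∀ n : ℕ, 0 < n → q ^ n ≠ 1) (n : ℕ) : 1 - q * q ^ n ≠ 0 := by
  intro h
  apply hroot (n+1) (by omega)
  rw [pow_succ]; linear_combination -h

lemma step0 (q y : ℂ) (hroot : ∀ n : ℕ, 0 < n → q ^ n ≠ 1) (j : ℕ) :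
    ff q y 0 (j+1) - (1 + q ^ (j+1)) * (1 - y * q ^ (2*j+1)) * ff q y 0 j = hh q y 0 j := by
  unfold ff hh
  have hj := qp_ne' q hroot j
  have hj1 := qp_ne' q hroot (j+1)
  simp only [zero_add, qp_zero, one_mul, mul_zero, tri_zero, tri_succ, pow_zero, mul_one,
    div_self hj, div_self hj1]
  have e1 : qPoch (y * q ^ (j+1)) q j * (1 - y * q ^ (2*j+1)) =
      (1 - y * q ^ (j+1)) * qPoch (y * q ^ (j+2)) q j := by
    have a := qp_succ (y * q ^ (j+1)) q j
    rw [qp_succ_left, mul_assoc y, ← pow_succ, mul_assoc y, ← pow_add] at a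
    rw [a]; congr 4; omega
  have e2 : qPoch (y * q ^ (j+1+1)) q (j+1) = qPoch (y * q ^ (j+2)) q j * (1 - y * q^(2*j+2)) := by
    rw [qp_succ, mul_assoc y, ← pow_add]; congr 4; omega
  rw [e2, qp_succ y, qp_zero]
  linear_combination (-(1 + q ^ (j+1))) * e1

lemma step1 (q y : ℂ) (hroot : ∀ n : ℕ, 0 < n → q ^ n ≠ 1) (k j : ℕ) :
    hh q y k (j+1) + ff q y (k+1) (j+1)
      - (1 + q ^ (k+j+2)) * (1 - y * q ^ (2*k+2*j+3)) * ff q y (k+1) j = hh q y (k+1) j := by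
  unfold ff hh
  have hj := qp_ne' q hroot j
  have hk := qp_ne' q hroot k
  have h1 := one_sub_ne q hroot j
  have h2 := one_sub_ne q hroot k
  have e1 : qPoch (y * q ^ (2*k+j+3)) q j * (1 - y * q ^ (2*k+2*j+3)) =
      (1 - y * q ^ (2*k+j+3)) * qPoch (y * q ^ (2*k+j+4)) q j := by
    have a := qp_succ (y * q ^ (2*k+j+3)) q j
    rw [qp_succ_left, mul_assoc y, ← pow_succ, mul_assoc y, ← pow_add] at a
    rw [a]; congr 4; omega
  have e2 : qPoch (y * q ^ (2*k+j+4)) q (j+1) =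
      qPoch (y * q ^ (2*k+j+4)) q j * (1 - y * q^(2*k+2*j+4)) := by
    rw [qp_succ, mul_assoc y, ← pow_add]; congr 4; omega
  have e3 : qPoch (y * q ^ (2*k+j+3)) q (j+1) =
      (1 - y * q ^ (2*k+j+3)) * qPoch (y * q ^ (2*k+j+4)) q j := by
    rw [qp_succ_left, mul_assoc y, ← pow_succ]
  rw [show 2*k+(j+1)+2 = 2*k+j+3 by ring, show 2*(k+1)+(j+1)+1 = 2*k+j+4 by ring,
    show 2*(k+1)+j+1 = 2*k+j+3 by ring, show 2*(k+1)+j+2 = 2*k+j+4 by ring,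
    show k+1+(j+1) = k+j+1+1 by ring, show k+1+j = k+j+1 by ring,
    show k+(j+1) = k+j+1 by ring, e2, e3]
  simp only [qp_succ y, qp_succ q, tri_succ]
  generalize qPoch (y * q ^ (2*k+j+4)) q j = P at *
  generalize qPoch (y * q ^ (2*k+j+3)) q j = R at *
  generalize qPoch q q j = A at *
  generalize qPoch q q k = B at *
  generalize qPoch q q (k+j) = D at *
  generalize qPoch y q k = Y at *
  have : ∀ c : ℂ, (1 + q ^ (k+j+2)) * (1 - y * q ^ (2*k+2*j+3)) * (c * R) =
     (1 + q ^ (k+j+2)) * c * ((1 - y * q ^ (2*k+j+3)) * P) := by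
    intro c; linear_combination (1 + q ^ (k+j+2)) * c * e1
  rw [this]
  clear this e1 e2 e3
  have p1 : q ^ (2*k+j+3) = q^3 * (q^k)^2 * q^j := by ring
  have p2 : q ^ (k+j+2) = q^2 * (q^k) * q^j := by ring
  have p3 : q ^ (2*k+2*j+4) = q^4 * (q^k)^2 * (q^j)^2 := by ring
  have p4 : q ^ (k+j+1) = q * (q^k) * q^j := by ring
  have p5 : q ^ (k+j) = (q^k) * q^j := by ring
  have p6 : q ^ (tri k + k + 1) = q ^ tri k * q ^ k * q := by ring
  have p7 : q ^ (j+1+(tri k + k + 1)) = q ^ tri k * q ^ k * q^j * q^2 := by ring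
  have p8 : q ^ (j+(tri k + k + 1+(k+1)+1)) = q ^ tri k * (q ^ k)^2 * q^j * q^3 := by ring
  have p9 : q ^ (k+1) = q^k * q := by ring
  rw [p1, p2, p3, p4, p5, p6, p7, p8, p9]
  generalize q ^ tri k = T at *
  generalize q ^ k = K at *
  generalize q ^ j = J at *
  generalize hU : 1 - q * K = U at *
  generalize hV : 1 - q * J = V at *
  field_simp
  rw [← hU, ← hV]
  ring

lemma partial_sum (q y : ℂ) (hroot : ∀ n : ℕ, 0 < n → q ^ n ≠ 1) (k : ℕ) : ∀ j : ℕ,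
    ∑ i ∈ range (k+1), (ff q y i (k+j+1-i)
      - (1 + q ^ (k+j+1)) * (1 - y * q ^ (2*(k+j)+1)) * ff q y i (k+j-i)) = hh q y k j := by
  induction k with
  | zero => intro j; simpa using step0 q y hroot j
  | succ k ih =>
    intro j
    rw [Finset.sum_range_succ]
    have := ih (j+1)
    rw [show k+(j+1) = k+1+j by ring] at this
    rw [this, ← step1 q y hroot k j, show k+1+j+1-(k+1) = j+1 by omega,
      show k+1+j-(k+1) = j by omega, show k+1+j+1 = k+j+2 by ring,
      show 2*(k+1+j)+1 = 2*k+2*j+3 by ring]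
    ring

lemma main_id (q y : ℂ) (hroot : ∀ n : ℕ, 0 < n → q ^ n ≠ 1) (N : ℕ) :
    ∑ i ∈ range (N+1), ff q y i (N-i) = qPoch (-q) q N * qPoch (y*q) (q^2) N := by
  induction N with
  | zero => simp [ff, qp_zero, tri_zero]
  | succ N ih =>
    have h := partial_sum q y hroot N 0
    rw [Finset.sum_sub_distrib, ← Finset.mul_sum] at h
    simp only [add_zero] at h
    rw [ih] at h
    rw [Finset.sum_range_succ, qp_succ, qp_succ]
    have e : ff q y (N+1) (N+1-(N+1)) = - hh q y N 0 := by
      have h1 := qp_ne' q hroot (N+1)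
      have h2 := qp_ne' q hroot N
      simp [ff, hh, qp_zero, div_self h1, div_self h2]
    rw [e]
    have p : y * q * (q^2)^N = y * q^(2*N+1) := by rw [← pow_mul]; ring
    rw [p]
    linear_combination h

lemma term_id (q : ℂ) (M : ℕ) (hq0 : q ≠ 0) (hroot : ∀ n : ℕ, 0 < n → q ^ n ≠ 1) (k i : ℕ) :
    qPoch (q ^ (-((k+i : ℕ) : ℤ))) q i * qPoch (q ^ (-((M : ℤ) + 2 * (k+i : ℕ) + 2))) q i /
          (qPoch q q i * qPoch (q ^ (-((M : ℤ) + (k+i : ℕ) + 1))) q i) *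
          (-(q ^ (k + i + 1))) ^ i * (q ^ tri (k+i) * qPoch (q ^ (M+2)) q (k+i)) =
      ff q (q ^ (M+2)) k i := by
  have a1 := qp_neg q hq0 k i
  have a2 := qp_neg q hq0 (M+2*k+i+2) i
  have a3 := qp_neg q hq0 (M+k+1) i
  rw [show (-(((M+2*k+i+2 : ℕ) : ℤ) + i)) = (-((M : ℤ) + 2 * (k+i : ℕ) + 2)) by push_cast; ring] at a2
  rw [show (-(((M+k+1 : ℕ) : ℤ) + i)) = (-((M : ℤ) + (k+i : ℕ) + 1)) by push_cast; ring] at a3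
  rw [show (-((k : ℤ) + i)) = (-((k+i : ℕ) : ℤ)) by push_cast; ring] at a1
  have n1 := qp_ne' q hroot i
  have n2 := qp_ne' q hroot k
  have n3 := qp_ne q hroot (M+k+1) i
  have hs : ((-1 : ℂ)^i) ≠ 0 := by simp
  have hss : ((-1 : ℂ)^i) * (-1)^i = 1 := by rw [← mul_pow]; simp
  have n4 : qPoch (q ^ (-((M : ℤ) + (k+i : ℕ) + 1))) q i ≠ 0 := by
    intro h; rw [h, zero_mul] at a3
    exact mul_ne_zero hs n3 a3.symm
  unfold ff
  have b1 : qPoch q q (k+i) = qPoch q q k * qPoch (q ^ (k+1)) q i := by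
    rw [qp_add]; congr 2; ring
  have b2 : qPoch (q ^ (M+2)) q (k+i) = qPoch (q^(M+2)) q k * qPoch (q ^ (M+k+1+1)) q i := by
    rw [qp_add]; congr 2; ring
  have b3 : q ^ (M+2) * q ^ (2*k+i+1) = q ^ (M+2*k+i+2+1) := by ring
  rw [b1, b2, b3]
  generalize qPoch (q ^ (-((M : ℤ) + (k+i : ℕ) + 1))) q i = X3 at *
  generalize qPoch (q ^ (-((M : ℤ) + 2 * (k+i : ℕ) + 2))) q i = X2 at *
  generalize qPoch (q ^ (-((k+i : ℕ) : ℤ))) q i = X1 at *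
  generalize qPoch (q ^ (M+k+1+1)) q i = Y3 at *
  generalize qPoch (q ^ (M+2*k+i+2+1)) q i = Y2 at *
  generalize qPoch (q ^ (k+1)) q i = Y1 at *
  generalize qPoch (q ^ (M+2)) q k = Z at *
  rw [neg_pow, ← pow_mul]
  generalize (-1 : ℂ)^i = s at *
  have key : X1 * X2 * s * q ^ ((k+i+1)*i) * q ^ tri (k+i) * Y3 = Y1 * q ^ tri k * Y2 * X3 := by
    have hE : q ^ ((k * i + tri i) + ((M+2*k+i+2)*i + tri i)) ≠ 0 := pow_ne_zero _ hq0
    apply mul_right_cancel₀ hE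
    have c1 : X1 * X2 * s * q ^ ((k+i+1)*i) * q ^ tri (k+i) * Y3 *
        q ^ ((k * i + tri i) + ((M+2*k+i+2)*i + tri i)) =
        (X1 * q ^ (k*i+tri i)) * (X2 * q ^ ((M+2*k+i+2)*i + tri i)) * (s * Y3) *
          q ^ ((k+i+1)*i + tri (k+i)) := by
      rw [pow_add q (k*i+tri i), pow_add q ((k+i+1)*i)]; ring
    have c2 : (k * i + tri i) + ((M+2*k+i+2)*i + tri i) + tri k =
        ((M+k+1)*i + tri i) + ((k+i+1)*i + tri (k+i)) := by
      rw [tri_add]; ring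
    have c3 : Y1 * q ^ tri k * Y2 * X3 * q ^ ((k * i + tri i) + ((M+2*k+i+2)*i + tri i)) =
        Y1 * Y2 * X3 * q ^ ((k * i + tri i) + ((M+2*k+i+2)*i + tri i) + tri k) := by
      rw [pow_add q _ (tri k)]; ring
    rw [c1, c3, c2, a1, a2, ← a3, pow_add q ((M+k+1)*i + tri i)]
    linear_combination Y1 * Y2 * X3 * q ^ ((M+k+1)*i + tri i) * q ^ ((k+i+1)*i + tri (k+i)) * hss
  generalize q ^ ((k+i+1)*i) = E1 at *
  generalize q ^ tri (k+i) = E2 at *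
  generalize q ^ tri k = E3 at *
  clear a1 a2 a3
  field_simp
  linear_combination Z * key

theorem stmt_5 (q : ℂ) (M N : ℕ) (hq : ‖q‖ < 1) (hq0 : q ≠ 0)
    (hroot : ∀ n : ℕ, 0 < n → q ^ n ≠ 1) :
    ∑ i ∈ Finset.range (N + 1),
        qPoch (q ^ (-(N : ℤ))) q i * qPoch (q ^ (-((M : ℤ) + 2 * N + 2))) q i /
          (qPoch q q i * qPoch (q ^ (-((M : ℤ) + N + 1))) q i) *
          (-(q ^ (N + 1))) ^ i =
      qPoch (-q) q N * qPoch (q ^ (M + 3)) (q ^ 2) N /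
        (q ^ (N * (N + 1) / 2) * qPoch (q ^ (M + 2)) q N) := by
  have hne : q ^ (N * (N + 1) / 2) * qPoch (q ^ (M + 2)) q N ≠ 0 :=
    mul_ne_zero (pow_ne_zero _ hq0) (qp_ne q hroot (M+1) N)
  rw [eq_div_iff hne, Finset.sum_mul]
  have h := main_id q (q ^ (M+2)) hroot N
  rw [show q ^ (M+2) * q = q ^ (M+3) by ring] at h
  rw [← h, ← Finset.sum_range_reflect]
  apply Finset.sum_congr rfl
  intro i hi
  have hi' : i ≤ N := by simpa [Nat.lt_succ_iff] using hi
  obtain ⟨j, rfl⟩ := Nat.exists_eq_add_of_le hi'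
  have := term_id q M hq0 hroot i j
  rw [show i + j + 1 - 1 - i = j by omega, show i + j - i = j by omega]
  exact this
end
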